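/- Let G be a multi-GGS-group that is not the GGS-group 𝒢 defined by a constant vector. Then ψ(γ₃(st_G(1))) = γ₃(G) × ⋯ × γ₃(G) (p factors). -/

import Mathlib

/-!
Automorphisms of the `p`-regular rooted tree, encoded by portraits:
an automorphism is a family of permutations of `Fin p`, one for each vertex
(vertices are finite words over `Fin p`, the root being `[]`).
-/

namespace TreeAut

variable {p : ℕ}

/-- Automorphisms of the `p`-regular rooted tree, given by their portraits. -/
def AutT (p : ℕ) : Type := List (Fin p) → Equiv.Perm (Fin p)

namespace AutT

/-- The action of a tree automorphism on the vertices (finite words over `Fin p`). -/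
def act : AutT p → List (Fin p) → List (Fin p)
  | _, [] => []
  | f, x :: w => f [] x :: act (fun v => f (x :: v)) w

/-- The section of `f` at the level-one vertex `x`; the map
`f ↦ (sections f 0, …, sections f (p-1))` restricted to the first-level
stabilizer is the isomorphism `ψ`. -/
def sections (f : AutT p) : Fin p → AutT p := fun x v => f (x :: v)

instance : One (AutT p) := ⟨fun _ => 1⟩

instance : Mul (AutT p) := ⟨fun f g v => f (act g v) * g v⟩

/-- The action of the inverse automorphism on vertices. -/
def invAct : AutT p → List (Fin p) → List (Fin p)
  | _, [] => []
  | f, x :: w => (f [])⁻¹ x :: invAct (fun v => f (((f [])⁻¹ x) :: v)) w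

instance : Inv (AutT p) := ⟨fun f v => (f (invAct f v))⁻¹⟩

lemma one_apply (v : List (Fin p)) : (1 : AutT p) v = 1 := rfl

lemma mul_apply (f g : AutT p) (v : List (Fin p)) : (f * g) v = f (act g v) * g v := rfl

lemma inv_apply (f : AutT p) (v : List (Fin p)) : f⁻¹ v = (f (invAct f v))⁻¹ := rfl

lemma act_nil (f : AutT p) : act f [] = [] := rfl

lemma act_cons (f : AutT p) (x : Fin p) (w : List (Fin p)) :
    act f (x :: w) = f [] x :: act (sections f x) w := rfl

lemma sections_mul (f g : AutT p) (x : Fin p) :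
    sections (f * g) x = sections f (g [] x) * sections g x :=
  funext fun _ => rfl

lemma act_one : ∀ v : List (Fin p), act (1 : AutT p) v = v
  | [] => rfl
  | x :: w => congrArg (x :: ·) (act_one w)

lemma act_mul (f g : AutT p) : ∀ v : List (Fin p), act (f * g) v = act f (act g v)
  | [] => rfl
  | x :: w => by
      rw [act_cons (f * g), sections_mul, act_mul, act_cons g, act_cons f]
      rfl

lemma invAct_act (f : AutT p) : ∀ v : List (Fin p), invAct f (act f v) = v
  | [] => rfl
  | x :: w => by
      rw [act_cons]
      show (f [])⁻¹ (f [] x) ::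
          invAct (fun v => f (((f [])⁻¹ (f [] x)) :: v)) (act (sections f x) w) = x :: w
      refine (congrArg (fun y => y :: invAct (sections f y) (act (sections f x) w))
        (Equiv.symm_apply_apply (f []) x)).trans ?_
      exact congrArg (x :: ·) (invAct_act (sections f x) w)

instance : Group (AutT p) where
  mul_assoc f g h := by
    funext v
    show (f * g) (act h v) * h v = f (act (g * h) v) * (g * h) v
    rw [mul_apply, mul_apply, act_mul, mul_assoc]
  one_mul f := by
    funext v
    show (1 : AutT p) (act f v) * f v = f v
    rw [one_apply, one_mul]
  mul_one f := by
    funext v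
    show f (act (1 : AutT p) v) * (1 : AutT p) v = f v
    rw [act_one, one_apply, mul_one]
  inv_mul_cancel f := by
    funext v
    show f⁻¹ (act f v) * f v = (1 : AutT p) v
    rw [inv_apply, invAct_act, one_apply, inv_mul_cancel]

lemma act_length (f : AutT p) : ∀ v : List (Fin p), (act f v).length = v.length
  | [] => rfl
  | _ :: w => congrArg Nat.succ (act_length _ w)

lemma act_act_inv (f : AutT p) (v : List (Fin p)) : act f (act f⁻¹ v) = v := by
  rw [← act_mul, mul_inv_cancel, act_one]

/-- The pointwise stabilizer `st(n)` of the `n`-th level of the tree. -/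
def levelStab (p n : ℕ) : Subgroup (AutT p) where
  carrier := {f | ∀ v : List (Fin p), v.length = n → act f v = v}
  one_mem' := fun v _ => act_one v
  mul_mem' := by
    intro f g hf hg v hv
    rw [act_mul, hg v hv, hf v hv]
  inv_mem' := by
    intro f hf v hv
    have h1 : act f (act f⁻¹ v) = v := act_act_inv f v
    have h2 : act f (act f⁻¹ v) = act f⁻¹ v := hf _ (by rw [act_length, hv])
    exact h2.symm.trans h1

instance levelStab_normal (p n : ℕ) : (levelStab p n).Normal := by
  constructor
  intro f hf g v hv
  show act (g * f * g⁻¹) v = v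
  rw [act_mul, act_mul, hf _ (by rw [act_length, hv]), act_act_inv]

/-- The tuple of sections at the level-two vertices.  Restricted to the
second-level stabilizer this is the map `ψ₂`. -/
def sections2 (f : AutT p) : Fin p → Fin p → AutT p := fun x y v => f (x :: y :: v)

/-- The rooted automorphism defined by a permutation `σ` of `Fin p`. -/
def rooted (σ : Equiv.Perm (Fin p)) : AutT p := fun v => if v = [] then σ else 1

/-- The rooted automorphism `a`, acting at the root by the cycle `(1 2 … p)`. -/
def rootedA (p : ℕ) : AutT p := rooted (finRotate p)

/-- Auxiliary portrait for the directed automorphism `b_e`. -/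
def directedAux (e : Fin (p - 1) → ZMod p) : List (Fin p) → Equiv.Perm (Fin p)
  | [] => 1
  | x :: w =>
      if h : (x : ℕ) < p - 1 then
        (if w = [] then finRotate p ^ ((e ⟨x, h⟩).val) else 1)
      else directedAux e w

/-- The directed automorphism `b_e` defined by the vector `e ∈ 𝔽_p^{p-1}`,
i.e. the unique automorphism with `ψ(b_e) = (a^{e_1}, …, a^{e_{p-1}}, b_e)`. -/
def directed (e : Fin (p - 1) → ZMod p) : AutT p := directedAux e

/-- The multi-GGS-group determined by the vectors `e 1, …, e r`. -/
def multiGGS (p : ℕ) {r : ℕ} (e : Fin r → Fin (p - 1) → ZMod p) : Subgroup (AutT p) :=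
  Subgroup.closure ({rootedA p} ∪ Set.range fun i => directed (e i))

/-- The GGS-group `𝒢` defined by the (nonzero) constant vector `(c, …, c)`. -/
def constGGS (p : ℕ) (c : ZMod p) : Subgroup (AutT p) :=
  Subgroup.closure {rootedA p, directed (fun _ => c)}

/-- `G` is the GGS-group `𝒢` defined by a constant vector. -/
def IsConstGGS {p : ℕ} (G : Subgroup (AutT p)) : Prop :=
  ∃ c : ZMod p, c ≠ 0 ∧ G = constGGS p c

/-- The stabilizer `st_G(n) = G ∩ st(n)`, viewed as a subgroup of `G`. -/
def stabIn {p : ℕ} (G : Subgroup (AutT p)) (n : ℕ) : Subgroup G :=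
  (levelStab p n).comap G.subtype

instance {p : ℕ} (G : Subgroup (AutT p)) (n : ℕ) : (stabIn G n).Normal :=
  Subgroup.Normal.comap (levelStab_normal p n) G.subtype

/-- The congruence subgroup property: every finite-index subgroup of `G`
contains a level stabilizer `st_G(n)`. -/
def HasCSP {p : ℕ} (G : Subgroup (AutT p)) : Prop :=
  ∀ H : Subgroup G, H.FiniteIndex → ∃ n : ℕ, stabIn G n ≤ H

/-- `G` is just infinite: it is infinite and all its nontrivial normal
subgroups have finite index. -/
def JustInfinite {p : ℕ} (G : Subgroup (AutT p)) : Prop :=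
  Infinite G ∧ ∀ N : Subgroup G, N.Normal → N ≠ ⊥ → N.FiniteIndex

end AutT

end TreeAut

open TreeAut AutT Subgroup

open scoped commutatorElement

theorem geometric_of_cross_eq {p : ℕ} [Fact p.Prime] {ι : Type*} {e : ι → ZMod p → ZMod p}
    {δ : ZMod p} (hδ : δ ≠ 0) {t : ι} (ht : e t δ ≠ 0) (hp : 2 < p)
    (h : ∀ s t i j, i ≠ 0 → i + δ ≠ 0 → j ≠ 0 → j + δ ≠ 0 →
      e s i * e t (j + δ) = e s (i + δ) * e t j) :
    ∃ κ : ZMod p, ∀ s, ∀ m : ℕ, m + 1 < p → e s ((m + 1 : ℕ) * δ) = κ ^ m * e s δ := by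
  have hcast : ∀ m : ℕ, 0 < m → m < p → ((m : ℕ) : ZMod p) * δ ≠ 0 := by
    intro m h0 hm
    refine mul_ne_zero ?_ hδ
    rw [Ne, ZMod.natCast_eq_zero_iff]
    exact Nat.not_dvd_of_pos_of_lt h0 hm
  refine ⟨e t (δ + δ) / e t δ, fun s m => ?_⟩
  induction m with
  | zero => intro _; simp
  | succ m ih =>
    intro hm
    have hstep : (((m + 1 + 1 : ℕ) : ZMod p)) * δ = ((m + 1 : ℕ) : ZMod p) * δ + δ := by
      push_cast; ring
    have h2 : δ + δ ≠ 0 := by simpa [add_mul, one_add_one_eq_two, two_mul] using hcast 2 (by omega) hp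
    have key := h s t (((m + 1 : ℕ) : ZMod p) * δ) δ (hcast _ (by omega) (by omega))
      (by rw [← hstep]; exact hcast _ (by omega) hm) hδ h2
    rw [hstep, pow_succ]
    rw [ih (by omega)] at key
    apply mul_right_cancel₀ ht
    rw [← key]
    generalize e t (δ + δ) = y
    field_simp

theorem defining_vectors_trichotomy {p : ℕ} [Fact p.Prime] (hp : 2 < p) {ι : Type*}
    [Nonempty ι] {e : ι → ZMod p → ZMod p} (hne : ∀ s, ∃ m, m ≠ 0 ∧ e s m ≠ 0)
    (hind : ∀ s t, s ≠ t → ∀ (v : ZMod p → ZMod p) (c d : ZMod p),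
      (∀ m, m ≠ 0 → e s m = c * v m) → (∀ m, m ≠ 0 → e t m = d * v m) → False)
    (hconst : Subsingleton ι → ∀ s c, ∃ m, m ≠ 0 ∧ e s m ≠ c) :
    (∃ δ t s s' i j, e t δ ≠ 0 ∧ δ ≠ 0 ∧ i ≠ 0 ∧ i + δ ≠ 0 ∧ j ≠ 0 ∧ j + δ ≠ 0 ∧
      e s i * e s' (j + δ) ≠ e s (i + δ) * e s' j) ∨
    (Subsingleton ι ∧ ∃ δ t, e t δ ≠ 0 ∧ δ ≠ 0 ∧ e t (-δ) = 0) ∨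
    (Subsingleton ι ∧ p = 3 ∧ ∃ t δ, e t δ ≠ 0 ∧ δ ≠ 0 ∧ e t (-δ) = - e t δ) := by
  by_contra hcon
  push Not at hcon
  obtain ⟨hA, hB, hC⟩ := hcon
  have geo : ∀ δ t, e t δ ≠ 0 → δ ≠ 0 →
      ∃ κ : ZMod p, ∀ s, ∀ m : ℕ, m + 1 < p → e s ((m + 1 : ℕ) * δ) = κ ^ m * e s δ :=
    fun δ t ht hδ => geometric_of_cross_eq hδ ht hp
      fun s s' i j hi hi' hj hj' => hA δ t s s' i j ht hδ hi hi' hj hj'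
  have hmul : ∀ δ : ZMod p, δ ≠ 0 → ∀ x : ZMod p, x ≠ 0 →
      ∃ m : ℕ, m + 1 < p ∧ x = ((m + 1 : ℕ) : ZMod p) * δ ∧ (x / δ).val - 1 = m := by
    intro δ hδ x hx
    have h1 : 0 < (x / δ).val := by
      rw [ZMod.val_pos]; exact div_ne_zero hx hδ
    have h2 := ZMod.val_lt (x / δ)
    refine ⟨(x / δ).val - 1, by omega, ?_, rfl⟩
    rw [Nat.sub_add_cancel h1, ZMod.natCast_zmod_val]
    field_simp
  obtain ⟨t⟩ := ‹Nonempty ι›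
  obtain ⟨δ, hδ, ht⟩ := hne t
  obtain ⟨κ, hκ⟩ := geo δ t ht hδ
  have hsub : Subsingleton ι := by
    refine ⟨fun s s' => ?_⟩
    by_contra hss
    refine hind s s' hss (fun x => κ ^ ((x / δ).val - 1)) (e s δ) (e s' δ) ?_ ?_ <;>
    · intro x hx
      obtain ⟨m, hm, hxm, hm'⟩ := hmul δ hδ x hx
      rw [hm', mul_comm, ← hκ _ m hm, ← hxm]
  have hneg := hB hsub δ t ht hδ
  have hnegcast : -δ = (((p - 2) + 1 : ℕ) : ZMod p) * δ := by
    have : (((p - 2) + 1 : ℕ) : ZMod p) = -1 := by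
      rw [show p - 2 + 1 = p - 1 by omega, Nat.cast_sub (by omega)]; simp
    rw [this]; ring
  have hκ0 : κ ≠ 0 := by
    rintro rfl
    apply hneg
    rw [hnegcast, hκ t _ (by omega), zero_pow (by omega), zero_mul]
  have hκ1 : κ ≠ 1 := by
    rintro rfl
    obtain ⟨x, hx, hx'⟩ := hconst hsub t (e t δ)
    obtain ⟨m, hm, hxm, -⟩ := hmul δ hδ x hx
    apply hx'
    rw [hxm, hκ t m hm, one_pow, one_mul]
  have hfermat : κ ^ (p - 1) = 1 := ZMod.pow_card_sub_one_eq_one hκ0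
  by_cases h3 : p = 3
  · subst h3
    refine hC hsub rfl t δ ht hδ ?_
    rw [hnegcast, hκ t _ (by omega)]
    have : (κ - 1) * (κ + 1) = 0 := by
      have : κ ^ 2 = 1 := hfermat
      linear_combination this
    rcases mul_eq_zero.1 this with h | h
    · exact absurd (sub_eq_zero.1 h) hκ1
    · rw [eq_neg_of_add_eq_zero_left h]; norm_num
  · have hodd : p % 2 = 1 := (Nat.Prime.eq_two_or_odd Fact.out).resolve_left (by omega)
    obtain ⟨k, hk⟩ : ∃ k, p = 2 * k + 1 := ⟨p / 2, by omega⟩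
    have e2 : e t ((2 : ℕ) * δ) = κ * e t δ := by simpa using hκ t 1 (by omega)
    have e4 : e t ((4 : ℕ) * δ) = κ ^ 3 * e t δ := by simpa using hκ t 3 (by omega)
    have hδ2 : ((2 : ℕ) : ZMod p) * δ ≠ 0 := by
      refine mul_ne_zero ?_ hδ
      rw [Ne, ZMod.natCast_eq_zero_iff]
      exact Nat.not_dvd_of_pos_of_lt (by omega) hp
    obtain ⟨κ', hκ'⟩ := geo ((2 : ℕ) * δ) t (by rw [e2]; exact mul_ne_zero hκ0 ht) hδ2
    have e4' := hκ' t 1 (by omega)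
    have e1' := hκ' t k (by omega)
    have hk1 : ((k + 1 : ℕ) : ZMod p) * ((2 : ℕ) * δ) = δ := by
      have : ((2 * k + 1 : ℕ) : ZMod p) = 0 := by rw [← hk]; simp
      push_cast at this ⊢
      linear_combination δ * this
    rw [hk1, e2] at e1'
    rw [show (((1 + 1 : ℕ) : ZMod p)) * ((2 : ℕ) * δ) = (4 : ℕ) * δ by push_cast; ring, e4, e2]
      at e4'
    have hκ'' : κ' = κ ^ 2 := by
      have := mul_ne_zero hκ0 ht
      apply mul_right_cancel₀ this
      linear_combination -e4'
    rw [hκ'', ← pow_mul, show 2 * k = p - 1 by omega, hfermat, one_mul] at e1'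
    apply hκ1
    apply mul_right_cancel₀ ht
    rw [← e1', one_mul]

theorem commutator_top_le_of_closure {A : Type*} [Group A] {X : Set A}
    (hX : Subgroup.closure X = ⊤) {Z : Subgroup A} [Z.Normal]
    (h : ∀ x ∈ X, ∀ y ∈ X, ⁅x, y⁆ ∈ Z) : ⁅(⊤ : Subgroup A), (⊤ : Subgroup A)⁆ ≤ Z := by
  have hcl : Subgroup.closure (QuotientGroup.mk' Z '' X) = ⊤ := by
    rw [← MonoidHom.map_closure, hX, ← MonoidHom.range_eq_map,
      MonoidHom.range_eq_top_of_surjective _ (QuotientGroup.mk'_surjective Z)]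
  have hcomm : IsMulCommutative (Subgroup.closure (QuotientGroup.mk' Z '' X)) := by
    apply Subgroup.isMulCommutative_closure
    rintro _ ⟨x, hx, rfl⟩ _ ⟨y, hy, rfl⟩
    rw [← commutatorElement_eq_one_iff_mul_comm, ← map_commutatorElement]
    exact (QuotientGroup.eq_one_iff _).2 (h x hx y hy)
  rw [Subgroup.commutator_le]
  intro g _ g' _
  rw [← QuotientGroup.eq_one_iff, ← QuotientGroup.mk'_apply, map_commutatorElement,
    commutatorElement_eq_one_iff_mul_comm]
  exact setLike_mul_comm (s := Subgroup.closure (QuotientGroup.mk' Z '' X))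
    (by rw [hcl]; trivial) (by rw [hcl]; trivial)

/-- The elements that are central modulo `K`. -/
def centerMod {A : Type*} [Group A] (K : Subgroup A) [K.Normal] : Subgroup A :=
  (Subgroup.center (A ⧸ K)).comap (QuotientGroup.mk' K)

instance {A : Type*} [Group A] (K : Subgroup A) [K.Normal] : (centerMod K).Normal :=
  Subgroup.Normal.comap inferInstance _

theorem mem_centerMod_of_closure {A : Type*} [Group A] {X : Set A}
    (hX : Subgroup.closure X = ⊤) {K : Subgroup A} [K.Normal] {g : A}
    (h : ∀ x ∈ X, ⁅g, x⁆ ∈ K) : g ∈ centerMod K := by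
  have hcl : Subgroup.closure (QuotientGroup.mk' K '' X) = ⊤ := by
    rw [← MonoidHom.map_closure, hX, ← MonoidHom.range_eq_map,
      MonoidHom.range_eq_top_of_surjective _ (QuotientGroup.mk'_surjective K)]
  rw [centerMod, Subgroup.mem_comap, ← Subgroup.centralizer_univ, ← Subgroup.coe_top, ← hcl,
    Subgroup.centralizer_closure, Subgroup.mem_centralizer_iff]
  rintro _ ⟨x, hx, rfl⟩
  rw [eq_comm, ← commutatorElement_eq_one_iff_mul_comm, ← map_commutatorElement]
  exact (QuotientGroup.eq_one_iff _).2 (h x hx)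

theorem commutator_mem_of_mem_centerMod {A : Type*} [Group A] {K : Subgroup A} [K.Normal] {g : A}
    (hg : g ∈ centerMod K) (h : A) : ⁅g, h⁆ ∈ K := by
  rw [← QuotientGroup.eq_one_iff, ← QuotientGroup.mk'_apply, map_commutatorElement,
    commutatorElement_eq_one_iff_mul_comm]
  exact (Subgroup.mem_center_iff.1 hg _).symm

theorem exists_eq_ofAdd_pow {p : ℕ} [Fact p.Prime] {τ : ZMod p} (hτ : τ ≠ 0)
    (x : Multiplicative (ZMod p)) : ∃ n : ℕ, x = Multiplicative.ofAdd τ ^ n := by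
  refine ⟨(x.toAdd / τ).val, ?_⟩
  rw [← ofAdd_nsmul, nsmul_eq_mul, ZMod.natCast_zmod_val, div_mul_cancel₀ _ hτ, ofAdd_toAdd]

/-- In a group generated by the values of an additive family `α` over `ZMod p` and a commuting
family `b`, it suffices for `γ₃ ≤ K` that each `⁅b s, α τ⁆` is central modulo `K`. -/
theorem gamma3_top_le_of_mem_centerMod {A : Type*} [Group A] {p : ℕ} [Fact p.Prime] {ι : Type*}
    {α : Multiplicative (ZMod p) →* A} {b : ι → A}
    (hX : Subgroup.closure (Set.range α ∪ Set.range b) = ⊤)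
    (hb : ∀ s t, ⁅b s, b t⁆ = 1) {K : Subgroup A} [K.Normal] {τ : ZMod p} (hτ : τ ≠ 0)
    (h : ∀ s, ⁅b s, α (.ofAdd τ)⁆ ∈ centerMod K) :
    ⁅⁅(⊤ : Subgroup A), (⊤ : Subgroup A)⁆, (⊤ : Subgroup A)⁆ ≤ K := by
  have hαb : ∀ s x, ⁅b s, α x⁆ ∈ centerMod K := by
    intro s x
    obtain ⟨n, rfl⟩ := exists_eq_ofAdd_pow hτ x
    have h1 := h s
    rw [← QuotientGroup.eq_one_iff, ← QuotientGroup.mk'_apply, map_commutatorElement,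
      commutatorElement_eq_one_iff_commute] at h1 ⊢
    rw [map_pow, map_pow]
    exact h1.pow_right n
  have hle : ⁅(⊤ : Subgroup A), (⊤ : Subgroup A)⁆ ≤ centerMod K := by
    apply commutator_top_le_of_closure hX
    rintro _ (⟨x, rfl⟩ | ⟨s, rfl⟩) _ (⟨y, rfl⟩ | ⟨t, rfl⟩)
    · rw [← map_commutatorElement, commutatorElement_eq_one_iff_mul_comm.2 (mul_comm x y), map_one]
      exact one_mem _
    · rw [← commutatorElement_inv]
      exact inv_mem (hαb t x)
    · exact hαb s y
    · rw [hb]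
      exact one_mem _
  rw [Subgroup.commutator_le]
  exact fun g hg g' _ => commutator_mem_of_mem_centerMod (hle hg) g'

/-- `β` with `β 0 = b` and `β m = α (e m)` for `m ≠ 0`. -/
def directedTuple {A : Type*} [Group A] {p : ℕ}
    (α : Multiplicative (ZMod p) →* A) (b : A) (e : ZMod p → ZMod p) : ZMod p → A :=
  fun m => if m = 0 then b else α (.ofAdd (e m))

section
variable {A : Type*} [Group A] {p : ℕ} {ι : Type*}

theorem directedTuple_zero (α : Multiplicative (ZMod p) →* A) (b : A) (e : ZMod p → ZMod p) :
    directedTuple α b e 0 = b := if_pos rfl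

theorem directedTuple_of_ne (α : Multiplicative (ZMod p) →* A) (b : A) (e : ZMod p → ZMod p)
    {m : ZMod p} (hm : m ≠ 0) : directedTuple α b e m = α (.ofAdd (e m)) := if_neg hm

/-- A subgroup of `A^p` invariant under cyclic shifts and containing the tuples
`(b_s, a^{e_{s,1}}, …, a^{e_{s,p-1}})`, where `A` is generated by `a` and the commuting `b_s`. -/
structure IsDirectedSystem (α : Multiplicative (ZMod p) →* A) (b : ι → A)
    (e : ι → ZMod p → ZMod p) (S : Subgroup (ZMod p → A)) : Prop where
  closure_eq : Subgroup.closure (Set.range α ∪ Set.range b) = ⊤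
  commute : ∀ s t, ⁅b s, b t⁆ = 1
  pow_eq : ∀ s, b s ^ p = 1
  shift_mem : ∀ u ∈ S, ∀ k : ZMod p, (fun x => u (x + k)) ∈ S
  tuple_mem : ∀ s, directedTuple α (b s) (e s) ∈ S

/-- The elements of `A` which, placed in coordinate `0`, lie in `γ₃(S)`. -/
def coordGamma3 (S : Subgroup (ZMod p → A)) : Subgroup A :=
  ⁅⁅S, S⁆, S⁆.comap (MonoidHom.mulSingle (fun _ : ZMod p => A) 0)

theorem commutator_mem_coordGamma3 {S : Subgroup (ZMod p → A)} {c u : ZMod p → A}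
    (hc : c ∈ ⁅S, S⁆) (hu : u ∈ S) (h : ∀ x, x ≠ 0 → ⁅c x, u x⁆ = 1) :
    ⁅c 0, u 0⁆ ∈ coordGamma3 S := by
  have hcu : ⁅c, u⁆ ∈ ⁅⁅S, S⁆, S⁆ := Subgroup.commutator_mem_commutator hc hu
  have : Pi.mulSingle 0 ⁅c 0, u 0⁆ = ⁅c, u⁆ := by
    funext x
    by_cases hx : x = 0
    · subst hx; rw [Pi.mulSingle_eq_same]; rfl
    · rw [Pi.mulSingle_eq_of_ne hx]; exact (h x hx).symm
  rw [coordGamma3, Subgroup.mem_comap, MonoidHom.mulSingle_apply, this]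
  exact hcu

namespace IsDirectedSystem
variable {α : Multiplicative (ZMod p) →* A} {b : ι → A} {e : ι → ZMod p → ZMod p}
  {S : Subgroup (ZMod p → A)}

theorem exists_apply_zero_eq [Fact p.Prime] (H : IsDirectedSystem α b e S) {t : ι} {δ : ZMod p}
    (ht : e t δ ≠ 0) (hδ : δ ≠ 0) (g : A) : ∃ u ∈ S, u 0 = g := by
  have hmap : S.map (Pi.evalMonoidHom (fun _ : ZMod p => A) 0) = ⊤ := by
    rw [eq_top_iff, ← H.closure_eq, Subgroup.closure_le]
    rintro _ (⟨x, rfl⟩ | ⟨s, rfl⟩)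
    · obtain ⟨n, rfl⟩ := exists_eq_ofAdd_pow ht x
      refine ⟨(fun y => directedTuple α (b t) (e t) (y + δ)) ^ n,
        pow_mem (H.shift_mem _ (H.tuple_mem t) δ) _, ?_⟩
      simp only [Pi.evalMonoidHom_apply, Pi.pow_apply, zero_add]
      rw [directedTuple_of_ne _ _ _ hδ, ← map_pow]
    · exact ⟨_, H.tuple_mem s, directedTuple_zero _ _ _⟩
  have : g ∈ S.map (Pi.evalMonoidHom (fun _ : ZMod p => A) 0) := by rw [hmap]; trivial
  obtain ⟨u, hu, rfl⟩ := this
  exact ⟨u, hu, rfl⟩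

theorem coordGamma3_normal [Fact p.Prime] (H : IsDirectedSystem α b e S) {t : ι} {δ : ZMod p}
    (ht : e t δ ≠ 0) (hδ : δ ≠ 0) : (coordGamma3 S).Normal := by
  constructor
  intro k hk g
  obtain ⟨u, hu, rfl⟩ := H.exists_apply_zero_eq ht hδ g
  have : Pi.mulSingle 0 (u 0 * k * (u 0)⁻¹) = u * Pi.mulSingle 0 k * u⁻¹ := by
    funext x
    by_cases hx : x = 0
    · subst hx; simp
    · simp [Pi.mulSingle_eq_of_ne hx]
  rw [coordGamma3, Subgroup.mem_comap, MonoidHom.mulSingle_apply, this]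
  have hle : ⁅⁅S, S⁆, S⁆ ≤ ⁅S, S⁆ :=
    Subgroup.commutator_mono (Subgroup.commutator_le.2 fun _ h₁ _ h₂ =>
      mul_mem (mul_mem (mul_mem h₁ h₂) (inv_mem h₁)) (inv_mem h₂)) le_rfl
  have hconj : ∀ w : ZMod p → A, u * w * u⁻¹ = ⁅w, u⁆⁻¹ * w := fun w => by
    rw [commutatorElement_def]; group
  rw [hconj]
  exact mul_mem (inv_mem (Subgroup.commutator_mem_commutator (hle hk) hu)) hk

/-- The commutator of a tuple with a shifted tuple is supported on two coordinates. -/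
theorem commutator_tuple_apply (α : Multiplicative (ZMod p) →* A) (b : ι → A)
    (e : ι → ZMod p → ZMod p) (s t : ι) {δ : ZMod p} {x : ZMod p} (hx : x ≠ 0) (hx' : x ≠ -δ) :
    ⁅directedTuple α (b s) (e s), fun y => directedTuple α (b t) (e t) (y + δ)⁆ x = 1 := by
  change ⁅directedTuple α (b s) (e s) x, directedTuple α (b t) (e t) (x + δ)⁆ = 1
  rw [directedTuple_of_ne _ _ _ hx,
    directedTuple_of_ne _ _ _ (fun h => hx' (eq_neg_of_add_eq_zero_left h)),
    commutatorElement_eq_one_iff_mul_comm, ← map_mul α, ← map_mul α, mul_comm]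

theorem commutator_commutator_mem (H : IsDirectedSystem α b e S) (s t : ι) {δ : ZMod p}
    (hδ : δ ≠ 0) {u : ZMod p → A} (hu : u ∈ S)
    (h : ⁅⁅α (.ofAdd (e s (-δ))), b t⁆, u (-δ)⁆ = 1) :
    ⁅⁅b s, α (.ofAdd (e t δ))⁆, u 0⁆ ∈ coordGamma3 S := by
  have hc : ⁅directedTuple α (b s) (e s), fun y => directedTuple α (b t) (e t) (y + δ)⁆ ∈ ⁅S, S⁆ :=
    Subgroup.commutator_mem_commutator (H.tuple_mem s) (H.shift_mem _ (H.tuple_mem t) δ)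
  have := commutator_mem_coordGamma3 hc hu fun x hx => by
    by_cases hx' : x = -δ
    · subst hx'
      change ⁅⁅directedTuple α (b s) (e s) (-δ), directedTuple α (b t) (e t) (-δ + δ)⁆, u (-δ)⁆ = 1
      rw [neg_add_cancel, directedTuple_zero, directedTuple_of_ne _ _ _ hx, h]
    · rw [commutator_tuple_apply α b e s t hx hx', commutatorElement_one_left]
  change ⁅⁅directedTuple α (b s) (e s) 0, directedTuple α (b t) (e t) (0 + δ)⁆, u 0⁆ ∈ _ at this
  rwa [zero_add, directedTuple_zero, directedTuple_of_ne _ _ _ hδ] at this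

theorem gamma3_top_le_of_eq_zero [Fact p.Prime] [Subsingleton ι] (H : IsDirectedSystem α b e S)
    {t : ι} {δ : ZMod p} (ht : e t δ ≠ 0) (hδ : δ ≠ 0) (ht' : e t (-δ) = 0) :
    ⁅⁅(⊤ : Subgroup A), (⊤ : Subgroup A)⁆, (⊤ : Subgroup A)⁆ ≤ coordGamma3 S := by
  have := H.coordGamma3_normal ht hδ
  refine gamma3_top_le_of_mem_centerMod H.closure_eq H.commute ht fun s => ?_
  refine mem_centerMod_of_closure H.closure_eq fun x _ => ?_
  obtain ⟨u, hu, rfl⟩ := H.exists_apply_zero_eq ht hδ x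
  refine H.commutator_commutator_mem s t hδ hu ?_
  rw [Subsingleton.elim s t, ht', ofAdd_zero, map_one, commutatorElement_one_left,
    commutatorElement_one_left]

theorem exists_pair_eq [Fact p.Prime] (H : IsDirectedSystem α b e S) {s t : ι} {δ i j : ZMod p}
    (hi : i ≠ 0) (hi' : i + δ ≠ 0) (hj : j ≠ 0) (hj' : j + δ ≠ 0)
    (hdet : e s i * e t (j + δ) ≠ e s (i + δ) * e t j) (x y : ZMod p) :
    ∃ u ∈ S, u (-δ) = α (.ofAdd x) ∧ u 0 = α (.ofAdd y) := by
  set D := e s i * e t (j + δ) - e s (i + δ) * e t j with hD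
  have hD0 : D ≠ 0 := sub_ne_zero.2 hdet
  set m := (x * e t (j + δ) - y * e t j) / D
  set n := (y * e s i - x * e s (i + δ)) / D
  refine ⟨(fun z => directedTuple α (b s) (e s) (z + (i + δ))) ^ m.val *
    (fun z => directedTuple α (b t) (e t) (z + (j + δ))) ^ n.val,
    mul_mem (pow_mem (H.shift_mem _ (H.tuple_mem s) _) _)
      (pow_mem (H.shift_mem _ (H.tuple_mem t) _) _), ?_, ?_⟩
  · simp only [Pi.mul_apply, Pi.pow_apply, neg_add_cancel_comm_assoc]
    rw [directedTuple_of_ne _ _ _ hi, directedTuple_of_ne _ _ _ hj, ← map_pow α, ← map_pow α, ← map_mul,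
      ← ofAdd_nsmul, ← ofAdd_nsmul, ← ofAdd_add, nsmul_eq_mul, nsmul_eq_mul,
      ZMod.natCast_zmod_val, ZMod.natCast_zmod_val]
    congr 2
    simp only [m, n]
    field_simp
    rw [hD]; ring
  · simp only [Pi.mul_apply, Pi.pow_apply, zero_add]
    rw [directedTuple_of_ne _ _ _ hi', directedTuple_of_ne _ _ _ hj', ← map_pow α, ← map_pow α,
      ← map_mul, ← ofAdd_nsmul, ← ofAdd_nsmul, ← ofAdd_add, nsmul_eq_mul, nsmul_eq_mul,
      ZMod.natCast_zmod_val, ZMod.natCast_zmod_val]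
    congr 2
    simp only [m, n]
    field_simp
    rw [hD]; ring

theorem gamma3_top_le_of_det_ne [Fact p.Prime] (H : IsDirectedSystem α b e S)
    {t : ι} {δ : ZMod p} (ht : e t δ ≠ 0) (hδ : δ ≠ 0) {q q' : ι} {i j : ZMod p}
    (hi : i ≠ 0) (hi' : i + δ ≠ 0) (hj : j ≠ 0) (hj' : j + δ ≠ 0)
    (hdet : e q i * e q' (j + δ) ≠ e q (i + δ) * e q' j) :
    ⁅⁅(⊤ : Subgroup A), (⊤ : Subgroup A)⁆, (⊤ : Subgroup A)⁆ ≤ coordGamma3 S := by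
  have := H.coordGamma3_normal ht hδ
  refine gamma3_top_le_of_mem_centerMod H.closure_eq H.commute ht fun s => ?_
  refine mem_centerMod_of_closure H.closure_eq fun x hx => ?_
  obtain ⟨u, hu, hu1, rfl⟩ : ∃ u ∈ S, u (-δ) = 1 ∧ u 0 = x := by
    rcases hx with ⟨y, rfl⟩ | ⟨q'', rfl⟩
    · obtain ⟨u, hu, h1, h0⟩ := H.exists_pair_eq hi hi' hj hj' hdet 0 y.toAdd
      exact ⟨u, hu, by rw [h1, ofAdd_zero, map_one], by rw [h0, ofAdd_toAdd]⟩
    · obtain ⟨u, hu, h1, h0⟩ := H.exists_pair_eq hi hi' hj hj' hdet (-e q'' (-δ)) 0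
      refine ⟨u * directedTuple α (b q'') (e q''), mul_mem hu (H.tuple_mem q''), ?_, ?_⟩
      · rw [Pi.mul_apply, h1, directedTuple_of_ne _ _ _ (neg_ne_zero.2 hδ), ← map_mul, ← ofAdd_add,
          neg_add_cancel, ofAdd_zero, map_one]
      · rw [Pi.mul_apply, h0, directedTuple_zero, ofAdd_zero, map_one, one_mul]
  refine H.commutator_commutator_mem s t hδ hu ?_
  rw [hu1, commutatorElement_one_right]

end IsDirectedSystem

/-- If `⁅b, a⁆` commutes with `b a⁻¹` and `⁅b, a⁻¹⁆` commutes with `b a`, where `b ^ 3 = 1`, then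
`⁅b, a⁆` commutes with both `a` and `b`. -/
theorem commute_of_commute_mul_inv {Q : Type*} [Group Q] {a b : Q} (hb : b ^ 3 = 1)
    (h1 : Commute ⁅b, a⁆ (b * a⁻¹)) (h2 : Commute ⁅b, a⁻¹⁆ (b * a)) :
    Commute ⁅b, a⁆ a ∧ Commute ⁅b, a⁆ b := by
  have h3 : Commute ⁅b, a⁆ (a * b) := by
    have := (Commute.conj_iff a).2 h2.inv_left
    rw [commutatorElement_inv] at this
    rwa [show a * ⁅a⁻¹, b⁆ * a⁻¹ = ⁅b, a⁆ by simp only [commutatorElement_def]; group,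
      show a * (b * a) * a⁻¹ = a * b by group] at this
  have h4 : Commute ⁅b, a⁆ (a * b * a⁻¹) := by
    have := (h3.mul_right h1).pow_right 2
    have e : (a * b * (b * a⁻¹)) ^ 2 = a * (b ^ 3 * b) * a⁻¹ := by
      simp only [pow_succ, pow_zero, one_mul]; group
    rwa [e, hb, one_mul] at this
  have h5 : Commute ⁅b, a⁆ a := by
    have := h4.inv_right.mul_right h3
    rwa [show (a * b * a⁻¹)⁻¹ * (a * b) = a by group] at this
  refine ⟨h5, ?_⟩
  have := h5.inv_right.mul_right h3
  rwa [inv_mul_cancel_left] at this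

namespace IsDirectedSystem
variable {α : Multiplicative (ZMod p) →* A} {b : ι → A} {e : ι → ZMod p → ZMod p}
  {S : Subgroup (ZMod p → A)}

theorem commutator_mem_of_three {α : Multiplicative (ZMod 3) →* A} {e : ι → ZMod 3 → ZMod 3}
    {S : Subgroup (ZMod 3 → A)} (H : IsDirectedSystem α b e S) {t : ι} {δ : ZMod 3}
    (hδ : δ ≠ 0) (ht : e t (-δ) = - e t δ) :
    ⁅⁅b t, α (.ofAdd (e t δ))⁆, b t * (α (.ofAdd (e t δ)))⁻¹⁆ ∈ coordGamma3 S := by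
  have h3 : -δ + -δ = δ := by clear ht hδ; revert δ; decide
  have hu : directedTuple α (b t) (e t) * (fun x => directedTuple α (b t) (e t) (x + -δ)) ∈ S :=
    mul_mem (H.tuple_mem t) (H.shift_mem _ (H.tuple_mem t) _)
  have hδ' := neg_ne_zero.2 hδ
  have := H.commutator_commutator_mem t t hδ hu (by
    rw [Pi.mul_apply, h3, directedTuple_of_ne _ _ _ hδ, directedTuple_of_ne _ _ _ hδ', ht,
      ← map_mul, ← ofAdd_add, neg_add_cancel, ofAdd_zero, map_one, commutatorElement_one_right])
  rwa [Pi.mul_apply, zero_add, directedTuple_zero, directedTuple_of_ne _ _ _ hδ', ht, ofAdd_neg,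
    map_inv] at this

theorem gamma3_top_le_of_three [Subsingleton ι] {α : Multiplicative (ZMod 3) →* A}
    {e : ι → ZMod 3 → ZMod 3} {S : Subgroup (ZMod 3 → A)} (H : IsDirectedSystem α b e S)
    {t : ι} {δ : ZMod 3} (ht : e t δ ≠ 0) (hδ : δ ≠ 0) (ht' : e t (-δ) = - e t δ) :
    ⁅⁅(⊤ : Subgroup A), (⊤ : Subgroup A)⁆, (⊤ : Subgroup A)⁆ ≤ coordGamma3 S := by
  have : Fact (Nat.Prime 3) := ⟨Nat.prime_three⟩
  have := H.coordGamma3_normal ht hδ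
  have h1 := H.commutator_mem_of_three hδ ht'
  have h2 := H.commutator_mem_of_three (t := t) (neg_ne_zero.2 hδ) (by rw [neg_neg, ht', neg_neg])
  rw [ht', ofAdd_neg, map_inv, inv_inv] at h2
  rw [← QuotientGroup.eq_one_iff, ← QuotientGroup.mk'_apply, map_commutatorElement,
    map_commutatorElement, commutatorElement_eq_one_iff_commute] at h1 h2
  rw [map_mul, map_inv] at h1 h2
  obtain ⟨ha, hb⟩ := commute_of_commute_mul_inv (by rw [← map_pow, H.pow_eq, map_one]) h1 h2
  refine gamma3_top_le_of_mem_centerMod H.closure_eq H.commute ht fun s => ?_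
  refine mem_centerMod_of_closure H.closure_eq fun x hx => ?_
  rw [← QuotientGroup.eq_one_iff, ← QuotientGroup.mk'_apply, map_commutatorElement,
    map_commutatorElement, commutatorElement_eq_one_iff_commute, Subsingleton.elim s t]
  rcases hx with ⟨y, rfl⟩ | ⟨s', rfl⟩
  · obtain ⟨n, rfl⟩ := exists_eq_ofAdd_pow ht y
    rw [map_pow, map_pow]
    exact ha.pow_right n
  · rwa [Subsingleton.elim s' t]

theorem mem_gamma3 [Fact p.Prime] (H : IsDirectedSystem α b e S)
    (hK : ⁅⁅(⊤ : Subgroup A), (⊤ : Subgroup A)⁆, (⊤ : Subgroup A)⁆ ≤ coordGamma3 S)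
    {g : ZMod p → A} (hg : ∀ x, g x ∈ ⁅⁅(⊤ : Subgroup A), (⊤ : Subgroup A)⁆, (⊤ : Subgroup A)⁆) :
    g ∈ ⁅⁅S, S⁆, S⁆ := by
  refine Subgroup.pi_mem_of_mulSingle_mem g fun k => ?_
  have h0 : Pi.mulSingle 0 (g k) ∈ ⁅⁅S, S⁆, S⁆ := hK (hg k)
  let shift : (ZMod p → A) →* (ZMod p → A) :=
    { toFun := fun u x => u (x + -k), map_one' := rfl, map_mul' := fun _ _ => rfl }
  have hS : S.map shift ≤ S := by
    rintro _ ⟨u, hu, rfl⟩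
    exact H.shift_mem u hu (-k)
  have hle : ⁅⁅S, S⁆, S⁆.map shift ≤ ⁅⁅S, S⁆, S⁆ := by
    rw [Subgroup.map_commutator, Subgroup.map_commutator]
    exact Subgroup.commutator_mono (Subgroup.commutator_mono hS hS) hS
  have hk : shift (Pi.mulSingle 0 (g k)) = Pi.mulSingle k (g k) := by
    funext x
    change (Pi.mulSingle 0 (g k) : ZMod p → A) (x + -k) = _
    by_cases hx : x = k
    · subst hx; rw [add_neg_cancel, Pi.mulSingle_eq_same, Pi.mulSingle_eq_same]
    · rw [Pi.mulSingle_eq_of_ne hx, Pi.mulSingle_eq_of_ne]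
      rwa [← sub_eq_add_neg, sub_ne_zero]
  rw [← hk]
  exact hle ⟨_, h0, rfl⟩

end IsDirectedSystem
end

namespace TreeAut.AutT
variable {p : ℕ}

lemma rooted_mul (σ τ : Equiv.Perm (Fin p)) : rooted (σ * τ) = rooted σ * rooted τ := by
  funext v
  cases v with
  | nil => rfl
  | cons x v => rfl

lemma rooted_one : rooted (1 : Equiv.Perm (Fin p)) = 1 := by
  funext v
  cases v <;> rfl

lemma rootedA_pow (k : ℕ) : rootedA p ^ k = rooted (finRotate p ^ k) := by
  induction k with
  | zero => exact rooted_one.symm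
  | succ k ih => rw [pow_succ, pow_succ, ih, rooted_mul]; rfl

lemma sections_rooted (σ : Equiv.Perm (Fin p)) (x : Fin p) : sections (rooted σ) x = 1 := rfl

lemma finRotate_pow_apply {n : ℕ} (k : ℕ) (x : ZMod (n + 1)) :
    (finRotate (n + 1) ^ k) x = x + (k : ZMod (n + 1)) := by
  induction k with
  | zero =>
    rw [pow_zero, Nat.cast_zero, add_zero]
    rfl
  | succ k ih =>
    rw [pow_succ', Nat.cast_succ, ← add_assoc]
    exact (congrArg (finRotate (n + 1)) ih).trans (finRotate_apply (n := n + 1) _)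

lemma finRotate_pow_self {n : ℕ} : finRotate (n + 1) ^ (n + 1) = 1 := by
  ext1 x
  refine (finRotate_pow_apply (n + 1) x).trans ?_
  rw [ZMod.natCast_self]
  exact add_zero (M := ZMod (n + 1)) x

lemma rootedA_pow_self (n : ℕ) : rootedA (n + 1) ^ (n + 1) = 1 := by
  rw [rootedA_pow, finRotate_pow_self, rooted_one]

/-- The additive group `ℤ/p` acting through powers of the rooted automorphism `a`. -/
def rootedPow (n : ℕ) : Multiplicative (ZMod (n + 1)) →* AutT (n + 1) where
  toFun x := rootedA (n + 1) ^ x.toAdd.val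
  map_one' := by rw [toAdd_one, ZMod.val_zero, pow_zero]
  map_mul' x y := by
    rw [toAdd_mul, ZMod.val_add, ← pow_add, ← pow_eq_pow_mod _ (rootedA_pow_self n)]

/-- The automorphism fixing the first level with prescribed sections, i.e. `ψ⁻¹`. -/
def ofSections : (Fin p → AutT p) →* AutT p where
  toFun g
    | [] => 1
    | x :: v => g x v
  map_one' := by
    funext v
    cases v <;> rfl
  map_mul' g h := by
    funext v
    cases v <;> rfl

lemma eq_of_sections_eq {f g : AutT p} (h : f [] = g []) (h' : sections f = sections g) :
    f = g := by
  funext v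
  cases v with
  | nil => exact h
  | cons x v => exact congrFun (congrFun h' x) v

lemma mem_levelStab_one {f : AutT p} : f ∈ levelStab p 1 ↔ f [] = 1 := by
  constructor
  · intro hf
    ext1 x
    exact (List.cons.inj (hf [x] rfl)).1
  · intro hf v hv
    obtain ⟨x, rfl⟩ := List.length_eq_one_iff.1 hv
    rw [act_cons, hf, act_nil]
    rfl

lemma sections_directed_last {n : ℕ} (e : Fin n → ZMod (n + 1)) :
    sections (directed (p := n + 1) e) (Fin.last n) = directed (p := n + 1) e :=
  funext fun _ => dif_neg (lt_irrefl n)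

lemma sections_directed_castSucc {n : ℕ} (e : Fin n → ZMod (n + 1)) (i : Fin n) :
    sections (directed (p := n + 1) e) i.castSucc = rootedPow n (.ofAdd (e i)) := by
  change _ = rootedA (n + 1) ^ (e i).val
  rw [rootedA_pow]
  exact funext fun _ => dif_pos i.isLt

lemma directed_add {n : ℕ} (e f : Fin n → ZMod (n + 1)) :
    directed (p := n + 1) (e + f) = directed (p := n + 1) e * directed (p := n + 1) f := by
  refine funext fun v => ?_
  have hmul : ∀ x, sections (directed (p := n + 1) e * directed (p := n + 1) f) x =
      sections (directed (p := n + 1) e) x * sections (directed (p := n + 1) f) x :=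
    sections_mul _ _
  induction v with
  | nil => rfl
  | cons x v ih =>
    induction x using Fin.lastCases with
    | last =>
      have h := hmul (Fin.last n)
      rw [sections_directed_last, sections_directed_last] at h
      exact (congrFun (sections_directed_last (e + f)) v).trans (ih.trans (congrFun h v).symm)
    | cast i =>
      have h := hmul i.castSucc
      rw [sections_directed_castSucc, sections_directed_castSucc, ← map_mul, ← ofAdd_add] at h
      exact congrFun ((sections_directed_castSucc (e + f) i).trans h.symm) v

lemma directed_commute {n : ℕ} (e f : Fin n → ZMod (n + 1)) :
    directed (p := n + 1) e * directed (p := n + 1) f =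
      directed (p := n + 1) f * directed (p := n + 1) e := by
  rw [← directed_add, ← directed_add, add_comm e f]

lemma directed_pow_eq_one {n : ℕ} (e : Fin n → ZMod (n + 1)) :
    directed (p := n + 1) e ^ (n + 1) = 1 := by
  have h0 : directed (p := n + 1) (0 : Fin n → ZMod (n + 1)) = 1 := by
    have := directed_add (0 : Fin n → ZMod (n + 1)) 0
    rw [add_zero] at this
    exact left_eq_mul.1 this
  have h : ∀ k : ℕ, directed (p := n + 1) e ^ k = directed (p := n + 1) (k • e) := by
    intro k
    induction k with
    | zero => rw [pow_zero, zero_smul, h0]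
    | succ k ih => rw [pow_succ, succ_nsmul, directed_add, ih]
  rw [h, ← h0]
  congr 1
  funext i
  rw [Pi.smul_apply, nsmul_eq_mul, ZMod.natCast_self, zero_mul, Pi.zero_apply]

section multiGGS
variable {n r : ℕ} (e : Fin r → Fin n → ZMod (n + 1))

lemma rootedA_mem_multiGGS : rootedA (n + 1) ∈ multiGGS (n + 1) e :=
  subset_closure (Or.inl rfl)

lemma directed_mem_multiGGS (s : Fin r) : directed (p := n + 1) (e s) ∈ multiGGS (n + 1) e :=
  subset_closure (Or.inr ⟨s, rfl⟩)

lemma rootedPow_mem_multiGGS (x : Multiplicative (ZMod (n + 1))) :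
    rootedPow n x ∈ multiGGS (n + 1) e :=
  pow_mem (rootedA_mem_multiGGS e) _

lemma sections_mem_multiGGS {f : AutT (n + 1)} (hf : f ∈ multiGGS (n + 1) e) (x : Fin (n + 1)) :
    sections f x ∈ multiGGS (n + 1) e := by
  induction hf using closure_induction generalizing x with
  | mem f hf =>
    rcases hf with rfl | ⟨s, rfl⟩
    · exact one_mem _
    · induction x using Fin.lastCases with
      | last => exact (sections_directed_last (e s)).symm ▸ directed_mem_multiGGS e s
      | cast i => exact (sections_directed_castSucc (e s) i).symm ▸ rootedPow_mem_multiGGS e _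
  | one => exact one_mem _
  | mul f g _ _ hf hg =>
    rw [sections_mul]
    exact mul_mem (hf _) (hg _)
  | inv f _ hf =>
    have h : sections (f * f⁻¹) x = 1 := by rw [mul_inv_cancel]; rfl
    rw [sections_mul] at h
    rw [eq_inv_of_mul_eq_one_right h]
    exact inv_mem (hf _)

/-- The map `ψ⁻¹` on tuples of elements of a subgroup. -/
def ofSectionsIn (G : Subgroup (AutT p)) : (Fin p → G) →* AutT p :=
  ofSections.comp (G.subtype.compLeft (Fin p))

/-- `ψ(st_G(1))` as a subgroup of `G × ⋯ × G`. -/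
def stabSections (G : Subgroup (AutT p)) : Subgroup (Fin p → G) :=
  G.comap (ofSectionsIn G)

lemma map_stabSections :
    (stabSections (multiGGS (n + 1) e)).map (ofSectionsIn _) =
      levelStab (n + 1) 1 ⊓ multiGGS (n + 1) e := by
  ext f
  constructor
  · rintro ⟨g, hg, rfl⟩
    exact ⟨mem_levelStab_one.2 rfl, hg⟩
  · rintro ⟨hf, hf'⟩
    have h : ofSectionsIn _ (fun x => ⟨sections f x, sections_mem_multiGGS e hf' x⟩) = f :=
      eq_of_sections_eq (mem_levelStab_one.1 hf).symm rfl
    refine ⟨_, ?_, h⟩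
    change ofSectionsIn _ _ ∈ multiGGS (n + 1) e
    rwa [h]

lemma shift_mem_stabSections (u : ZMod (n + 1) → multiGGS (n + 1) e)
    (hu : u ∈ stabSections (multiGGS (n + 1) e)) (k : ZMod (n + 1)) :
    (fun x => u (x + k)) ∈ stabSections (multiGGS (n + 1) e) := by
  have h : rootedA (n + 1) ^ k.val * ofSectionsIn _ (fun x : ZMod (n + 1) => u (x + k)) =
      ofSectionsIn _ u * rootedA (n + 1) ^ k.val := by
    rw [rootedA_pow]
    refine eq_of_sections_eq rfl (funext fun x => ?_)
    rw [sections_mul, sections_mul, sections_rooted, sections_rooted, one_mul, mul_one]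
    have hx := finRotate_pow_apply k.val x
    rw [ZMod.natCast_zmod_val] at hx
    exact congrArg (fun y => (u y : AutT (n + 1))) hx.symm
  have ha := pow_mem (rootedA_mem_multiGGS e) k.val
  change ofSectionsIn _ _ ∈ multiGGS (n + 1) e
  rw [eq_inv_mul_of_mul_eq h]
  exact mul_mem (inv_mem ha) (mul_mem hu ha)

/-- The rooted automorphisms `a ^ x` as elements of the multi-GGS-group. -/
def rootedPowIn : Multiplicative (ZMod (n + 1)) →* multiGGS (n + 1) e :=
  (rootedPow n).codRestrict _ (rootedPow_mem_multiGGS e)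

lemma isDirectedSystem_multiGGS : IsDirectedSystem (rootedPowIn e)
    (fun s => (⟨directed (p := n + 1) (e s), directed_mem_multiGGS e s⟩ : multiGGS (n + 1) e))
    (fun s => Fin.cons (α := fun _ => ZMod (n + 1)) 0 (e s))
    (stabSections (multiGGS (n + 1) e)) where
  closure_eq := by
    refine top_unique ((closure_closure_coe_preimage (k := {rootedA (n + 1)} ∪
      Set.range fun s => directed (p := n + 1) (e s))).ge.trans (closure_mono ?_))
    rintro ⟨x, hx⟩ (rfl | ⟨s, rfl⟩)
    · refine Or.inl ⟨.ofAdd 1, Subtype.ext ?_⟩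
      change rootedA (n + 1) ^ (1 : ZMod (n + 1)).val = rootedA (n + 1)
      rw [ZMod.val_one_eq_one_mod, ← pow_eq_pow_mod _ (rootedA_pow_self n), pow_one]
    · exact Or.inr ⟨s, rfl⟩
  commute s t := by
    rw [commutatorElement_eq_one_iff_mul_comm]
    exact Subtype.ext (directed_commute _ _)
  pow_eq s := Subtype.ext (directed_pow_eq_one _)
  shift_mem := shift_mem_stabSections e
  tuple_mem s := by
    have h : ofSectionsIn _ (directedTuple (rootedPowIn e)
        ⟨directed (p := n + 1) (e s), directed_mem_multiGGS e s⟩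
        (Fin.cons (α := fun _ => ZMod (n + 1)) 0 (e s))) * rootedA (n + 1) =
        rootedA (n + 1) * directed (p := n + 1) (e s) := by
      refine eq_of_sections_eq rfl (funext fun x => ?_)
      rw [sections_mul, sections_mul, rootedA, sections_rooted, sections_rooted, one_mul, mul_one]
      induction x using Fin.lastCases with
      | last =>
        refine Eq.trans ?_ (sections_directed_last (e s)).symm
        exact congrArg Subtype.val ((congrArg (directedTuple _ _ _) finRotate_last).trans
          (directedTuple_zero ..))
      | cast i =>
        have hi : finRotate (n + 1) i.castSucc = i.succ := by
          rw [finRotate_apply, Fin.coeSucc_eq_succ]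
        refine Eq.trans ?_ (sections_directed_castSucc (e s) i).symm
        exact congrArg Subtype.val ((congrArg (directedTuple (rootedPowIn e) _ _) hi).trans
          (directedTuple_of_ne (p := n + 1) (m := Fin.succ i) (rootedPowIn e) _ _
            (Fin.succ_ne_zero i)))
    change ofSectionsIn _ _ ∈ multiGGS (n + 1) e
    rw [eq_mul_inv_of_mul_eq h]
    exact mul_mem (mul_mem (rootedA_mem_multiGGS e) (directed_mem_multiGGS e s))
      (inv_mem (rootedA_mem_multiGGS e))

end multiGGS

lemma coe_mem_gamma3_iff {A : Type*} [Group A] {G : Subgroup A} {x : G} :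
    (x : A) ∈ ⁅⁅G, G⁆, G⁆ ↔ x ∈ ⁅⁅(⊤ : Subgroup G), (⊤ : Subgroup G)⁆, (⊤ : Subgroup G)⁆ := by
  have h : ⁅⁅G, G⁆, G⁆ =
      ⁅⁅(⊤ : Subgroup G), (⊤ : Subgroup G)⁆, (⊤ : Subgroup G)⁆.map G.subtype := by
    rw [map_commutator, map_commutator, ← MonoidHom.range_eq_map, range_subtype]
  rw [h]
  exact mem_map_iff_mem G.subtype_injective

lemma isConstGGS_of_subsingleton {n r : ℕ} [Subsingleton (Fin r)]
    {e : Fin r → Fin n → ZMod (n + 1)} {s : Fin r} (hs : e s ≠ 0) {c : ZMod (n + 1)}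
    (hc : ∀ i, e s i = c) : IsConstGGS (p := n + 1) (multiGGS (n + 1) e) := by
  have hes : e s = fun _ => c := funext hc
  refine ⟨c, fun h0 => hs (by rw [hes, h0]; rfl), ?_⟩
  have : Nonempty (Fin r) := ⟨s⟩
  have hcst : (fun i => directed (p := n + 1) (e i)) = fun _ => directed (p := n + 1) fun _ => c :=
    funext fun i => by
      rw [Subsingleton.elim i s, hes]
      rfl
  rw [multiGGS, hcst, Set.range_const, constGGS, Set.singleton_union]

lemma gamma3_top_le_coordGamma3 {n r : ℕ} [Fact (n + 1).Prime] (hn : 2 < n + 1) (hr : 1 ≤ r)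
    {e : Fin r → Fin n → ZMod (n + 1)} (he : LinearIndependent (ZMod (n + 1)) e)
    (hG : ¬ IsConstGGS (multiGGS (n + 1) e)) :
    ⁅⁅(⊤ : Subgroup (multiGGS (n + 1) e)), (⊤ : Subgroup (multiGGS (n + 1) e))⁆,
      (⊤ : Subgroup (multiGGS (n + 1) e))⁆ ≤
      coordGamma3 (p := n + 1) (stabSections (multiGGS (n + 1) e)) := by
  have H := isDirectedSystem_multiGGS e
  have : Nonempty (Fin r) := ⟨⟨0, hr⟩⟩
  have hsucc : ∀ i : Fin n, ((Fin.succ i : Fin (n + 1)) : ZMod (n + 1)) ≠ 0 := Fin.succ_ne_zero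
  refine (defining_vectors_trichotomy hn (ι := Fin r)
    (e := fun s => Fin.cons (α := fun _ => ZMod (n + 1)) 0 (e s)) ?_ ?_ ?_).elim ?_
    (Or.rec ?_ ?_)
  · intro s
    obtain ⟨i, hi⟩ := Function.ne_iff.1 (he.ne_zero s)
    exact ⟨Fin.succ i, hsucc i, hi⟩
  · intro s t hst v c d hc hd
    have hc' : ∀ i, e s i = c * v (Fin.succ i) := fun i => hc _ (hsucc i)
    have hd' : ∀ i, e t i = d * v (Fin.succ i) := fun i => hd _ (hsucc i)
    have hzero : d • e s + (-c) • e t = 0 := by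
      funext i
      simp only [Pi.add_apply, Pi.smul_apply, smul_eq_mul, Pi.zero_apply, hc', hd']
      ring
    obtain ⟨-, hc0⟩ := (LinearIndepOn.pair_iff e hst).1
      ((linearIndepOn_univ_iff.2 he).mono (Set.subset_univ _)) d (-c) hzero
    refine he.ne_zero s (funext fun i => ?_)
    rw [hc', neg_eq_zero.1 hc0, zero_mul]
    rfl
  · intro _ s c
    by_contra! h
    exact hG (isConstGGS_of_subsingleton (he.ne_zero s) fun i => h (Fin.succ i) (hsucc i))
  · rintro ⟨δ, t, s, s', i, j, ht, hδ, hi, hi', hj, hj', hdet⟩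
    exact H.gamma3_top_le_of_det_ne ht hδ hi hi' hj hj' hdet
  · rintro ⟨_, δ, t, ht, hδ, ht'⟩
    exact H.gamma3_top_le_of_eq_zero ht hδ ht'
  · rintro ⟨_, h3, t, δ, ht, hδ, ht'⟩
    obtain rfl : n = 2 := by omega
    exact IsDirectedSystem.gamma3_top_le_of_three H ht hδ ht'

theorem sections_image_gamma3_stab {n r : ℕ} [Fact (n + 1).Prime] (hn : 2 < n + 1) (hr : 1 ≤ r)
    {e : Fin r → Fin n → ZMod (n + 1)} (he : LinearIndependent (ZMod (n + 1)) e)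
    (hG : ¬ IsConstGGS (multiGGS (n + 1) e)) :
    sections '' (⁅⁅levelStab (n + 1) 1 ⊓ multiGGS (n + 1) e,
        levelStab (n + 1) 1 ⊓ multiGGS (n + 1) e⁆,
        levelStab (n + 1) 1 ⊓ multiGGS (n + 1) e⁆ : Subgroup (AutT (n + 1))) =
      {g : Fin (n + 1) → AutT (n + 1) | ∀ x,
        g x ∈ ⁅⁅multiGGS (n + 1) e, multiGGS (n + 1) e⁆, multiGGS (n + 1) e⁆} := by
  have hK := gamma3_top_le_coordGamma3 hn hr he hG
  rw [← map_stabSections e, ← map_commutator, ← map_commutator]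
  ext g
  constructor
  · rintro ⟨_, ⟨u, hu, rfl⟩, rfl⟩ x
    change ((u x : multiGGS (n + 1) e) : AutT (n + 1)) ∈ _
    rw [coe_mem_gamma3_iff]
    have hux := mem_map_of_mem (Pi.evalMonoidHom (fun _ : Fin (n + 1) => multiGGS (n + 1) e) x) hu
    rw [map_commutator, map_commutator] at hux
    exact commutator_mono (commutator_mono le_top le_top) le_top hux
  · intro hg
    have hgG : ∀ x, g x ∈ multiGGS (n + 1) e := fun x =>
      (commutator_le_self _).trans' (commutator_mono (commutator_le_self _) le_rfl) (hg x)
    refine ⟨_, ⟨fun x => ⟨g x, hgG x⟩, ?_, rfl⟩, rfl⟩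
    exact (isDirectedSystem_multiGGS e).mem_gamma3 hK fun x => coe_mem_gamma3_iff.1 (hg x)

end TreeAut.AutT

/-- If the multi-GGS-group `G` is not the constant GGS-group `𝒢`, then
`ψ(γ₃(st_G(1))) = γ₃(G) × ⋯ × γ₃(G)` (`p` factors). -/
theorem psi_gamma3_stab_eq_of_not_constGGS
    (p r : ℕ) (hp : p.Prime) (hpodd : Odd p) (hr : 1 ≤ r)
    (e : Fin r → Fin (p - 1) → ZMod p) (he : LinearIndependent (ZMod p) e)
    (hG : ¬ IsConstGGS (multiGGS p e)) :
    sections '' ((⁅⁅levelStab p 1 ⊓ multiGGS p e, levelStab p 1 ⊓ multiGGS p e⁆, levelStab p 1 ⊓ multiGGS p e⁆ : Subgroup (AutT p)) : Set (AutT p))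
      = {g : Fin p → AutT p | ∀ x : Fin p, g x ∈ ⁅⁅multiGGS p e, multiGGS p e⁆, multiGGS p e⁆} := by
  obtain ⟨n, rfl⟩ : ∃ n, p = n + 1 := ⟨p - 1, (Nat.succ_pred_prime hp).symm⟩
  have : Fact (n + 1).Prime := ⟨hp⟩
  have hn : 2 < n + 1 := hp.two_le.lt_of_ne fun h => by
    rw [← h] at hpodd
    exact absurd hpodd (by decide)
  exact sections_image_gamma3_stab hn hr he hG
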